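/- Let U be a polynomial of degree at most N on [-1,1] and let ‖U‖_N² = Σ_{j=0}^N U(x_j)² w_j be the discrete norm induced by Legendre–Gauss–Lobatto quadrature with N+1 nodes. Then ‖U‖_{L²(-1,1)} ≤ ‖U‖_N ≤ √3 ‖U‖_{L²(-1,1)}. -/

import Mathlib

open Polynomial

/-- The degree-`n` Legendre polynomial (Rodrigues' formula). -/
noncomputable def legendreR (n : ℕ) : Polynomial ℝ :=
  C (1 / (2 ^ n * (n.factorial : ℝ))) * derivative^[n] ((X ^ 2 - 1) ^ n)

lemma leg_w_ode (n : ℕ) (w : ℝ[X]) (h : (X ^ 2 - 1) * derivative w = 2 * (n : ℝ[X]) * X * w)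
    (k : ℕ) :
    (X ^ 2 - 1) * derivative^[k+2] w =
      2 * ((n : ℝ[X]) - (k : ℝ[X]) - 1) * X * derivative^[k+1] w
      + ((k : ℝ[X]) + 1) * (2 * (n : ℝ[X]) - (k : ℝ[X])) * derivative^[k] w := by
  induction k with
  | zero =>
    have h2 := congrArg derivative h
    simp only [Function.iterate_succ, Function.iterate_zero, Function.comp, id] at *
    simp [derivative_mul] at h2
    simp
    linear_combination h2
  | succ k ih =>
    have h2 := congrArg derivative ih
    have e : ∀ m (f : ℝ[X]), derivative (derivative^[m] f) = derivative^[m+1] f := by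
      intro m f; rw [Function.iterate_succ_apply']
    simp only [derivative_mul, derivative_add, derivative_sub, derivative_natCast, e,
      derivative_X_pow, derivative_one, derivative_X, derivative_ofNat] at h2
    simp only [Nat.cast_ofNat, map_ofNat, Nat.add_one_sub_one, pow_one] at h2
    push_cast
    linear_combination h2

lemma leg_ode (n : ℕ) :
    derivative ((1 - X ^ 2) * derivative (legendreR n)) =
      - C ((n : ℝ) * (n + 1)) * legendreR n := by
  have h0 : ((X : ℝ[X]) ^ 2 - 1) * derivative ((X ^ 2 - 1) ^ n) =
      2 * (n : ℝ[X]) * X * (X ^ 2 - 1) ^ n := by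
    rcases n with _ | n
    · simp
    · rw [derivative_pow]
      simp
      ring
  have h := leg_w_ode n _ h0 n
  have e : ∀ m (f : ℝ[X]), derivative (derivative^[m] f) = derivative^[m+1] f := by
      intro m f; rw [Function.iterate_succ_apply']
  unfold legendreR
  generalize (1 / (2 ^ n * (n.factorial : ℝ))) = c
  generalize ((X : ℝ[X]) ^ 2 - 1) ^ n = w at *
  simp only [derivative_mul, derivative_sub, derivative_C, e, zero_mul, zero_add,
      derivative_X_pow, derivative_one]
  simp only [Nat.cast_ofNat, map_ofNat, Nat.add_one_sub_one, pow_one, map_mul, map_add,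
    map_natCast, map_one]
  linear_combination (-C c) * h

lemma leg_w_natDegree (n : ℕ) : (((X : ℝ[X]) ^ 2 - 1) ^ n).natDegree = 2 * n := by
  rw [natDegree_pow, ← C_1, natDegree_X_pow_sub_C, mul_comm]

lemma leg_natDegree (n : ℕ) : (legendreR n).natDegree ≤ n := by
  unfold legendreR
  refine (natDegree_C_mul_le _ _).trans ((natDegree_iterate_derivative _ _).trans ?_)
  rw [leg_w_natDegree]; omega

lemma leg_coeff (n : ℕ) : (legendreR n).coeff n ≠ 0 := by
  unfold legendreR
  rw [coeff_C_mul, coeff_iterate_derivative]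
  have : (((X : ℝ[X]) ^ 2 - 1) ^ n).coeff (n + n) = 1 := by
    have hm : (((X : ℝ[X]) ^ 2 - 1) ^ n).Monic := by
      refine Monic.pow ?_ n
      rw [← C_1]; exact monic_X_pow_sub_C _ (by norm_num)
    have := hm.coeff_natDegree
    rwa [leg_w_natDegree, two_mul] at this
  rw [this]
  have h : (n + n).descFactorial n ≠ 0 := by
    rw [Ne, Nat.descFactorial_eq_zero_iff_lt]; omega
  have := Nat.factorial_ne_zero n
  simp; tauto

lemma leg_one (n : ℕ) : (legendreR n).eval 1 ^ 2 = 1 := by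
  have h := aeval_iterate_derivative_self (A := ℝ) (((X : ℝ[X]) ^ 2 - 1) ^ n) n 1
    (p' := (X + 1) ^ n) (by simp [← mul_pow]; congr 1; ring)
  simp only [coe_aeval_eq_eval, nsmul_eq_mul, eval_pow, eval_add, eval_X, eval_one] at h
  have := Nat.factorial_ne_zero n
  unfold legendreR
  rw [eval_C_mul, h]
  norm_num
  field_simp
  simp

lemma leg_neg_one (n : ℕ) : (legendreR n).eval (-1) ^ 2 = 1 := by
  have h := aeval_iterate_derivative_self (A := ℝ) (((X : ℝ[X]) ^ 2 - 1) ^ n) n (-1)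
    (p' := (X - 1) ^ n) (by simp [← mul_pow]; congr 1; ring)
  simp only [coe_aeval_eq_eval, nsmul_eq_mul, eval_pow, eval_sub, eval_X, eval_one] at h
  have hf : (n.factorial : ℝ) ≠ 0 := by exact_mod_cast Nat.factorial_ne_zero n
  unfold legendreR
  rw [eval_C_mul, h]
  have e : ((-1 - 1 : ℝ) ^ n) ^ 2 = (2 ^ n) ^ 2 := by
    rw [← pow_mul, ← pow_mul, mul_comm, pow_mul, pow_mul]; norm_num
  rw [mul_pow, mul_pow, e]
  field_simp

/-- Integration over `[-1,1]` as a linear functional on polynomials. -/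
noncomputable def intI : ℝ[X] →ₗ[ℝ] ℝ where
  toFun p := ∫ t in (-1 : ℝ)..1, p.eval t
  map_add' p q := by
    simp only [eval_add]
    exact intervalIntegral.integral_add (p.continuous.intervalIntegrable _ _)
      (q.continuous.intervalIntegrable _ _)
  map_smul' c p := by
    simp

lemma intI_apply (p : ℝ[X]) : intI p = ∫ t in (-1 : ℝ)..1, p.eval t := rfl

lemma intI_C_mul (c : ℝ) (p : ℝ[X]) : intI (C c * p) = c * intI p := by
  rw [← smul_eq_C_mul, map_smul, smul_eq_mul]

lemma intI_derivative (p : ℝ[X]) : intI (derivative p) = p.eval 1 - p.eval (-1) := by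
  rw [intI_apply]
  exact intervalIntegral.integral_eq_sub_of_hasDerivAt (fun t _ => p.hasDerivAt t)
    (p.derivative.continuous.intervalIntegrable _ _)

section abs
variable {N : ℕ} {L : ℝ[X]}

lemma abs_green (hode : derivative ((1 - X ^ 2) * derivative L) = - C ((N : ℝ) * (N + 1)) * L)
    (q : ℝ[X]) :
    (N : ℝ) * (N + 1) * intI (L * q) = - intI (L * derivative ((1 - X ^ 2) * derivative q)) := by
  have h := intI_derivative ((1 - X ^ 2) * derivative L * q - (1 - X ^ 2) * derivative q * L)
  have e : derivative ((1 - X ^ 2) * derivative L * q - (1 - X ^ 2) * derivative q * L)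
     = - (C ((N : ℝ) * (N + 1)) * (L * q)) - L * derivative ((1 - X ^ 2) * derivative q) := by
    rw [derivative_sub, derivative_mul (f := (1 - X ^ 2) * derivative L), hode,
      derivative_mul (f := (1 - X ^ 2) * derivative q)]
    ring
  rw [e, map_sub, map_neg, intI_C_mul] at h
  simp only [eval_sub, eval_mul, eval_pow, eval_X, eval_one] at h
  have z1 : (1 - (1 : ℝ) ^ 2) = 0 := by norm_num
  have z2 : (1 - (-1 : ℝ) ^ 2) = 0 := by norm_num
  rw [z1, z2] at h
  linarith

lemma abs_parts (hode : derivative ((1 - X ^ 2) * derivative L) = - C ((N : ℝ) * (N + 1)) * L)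
    (q : ℝ[X]) :
    intI ((1 - X ^ 2) * derivative L * derivative q) = (N : ℝ) * (N + 1) * intI (L * q) := by
  have h := intI_derivative ((1 - X ^ 2) * derivative L * q)
  rw [derivative_mul, hode, map_add, neg_mul, neg_mul, map_neg, mul_assoc (C _), intI_C_mul] at h
  simp only [eval_sub, eval_mul, eval_pow, eval_X, eval_one] at h
  have z1 : (1 - (1 : ℝ) ^ 2) = 0 := by norm_num
  have z2 : (1 - (-1 : ℝ) ^ 2) = 0 := by norm_num
  rw [z1, z2] at h
  linarith

lemma abs_orth_pow
    (hode : derivative ((1 - X ^ 2) * derivative L) = - C ((N : ℝ) * (N + 1)) * L) :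
    ∀ m : ℕ, m < N → intI (L * X ^ m) = 0 := by
  intro m
  induction m using Nat.strong_induction_on with
  | _ m ih =>
    intro hm
    have h := abs_green hode (X ^ m)
    have hmR : (m : ℝ) < N := by exact_mod_cast hm
    match m, ih, hmR, h with
    | 0, _, hm, h =>
      simp at h
      norm_num at hm
      rcases h with (h | h) | h
      · subst h; simp at hm
      · have : (0:ℝ) ≤ N := by positivity
        linarith
      · simpa using h
    | 1, _, hm, h =>
      have e : L * derivative ((1 - X ^ 2) * derivative (X ^ 1)) = C (-2) * (L * X ^ 1) := by
        simp [map_ofNat]; ring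
      rw [e, intI_C_mul] at h
      push_cast at hm
      have h2 : ((N : ℝ) * (N + 1) - 2) * intI (L * X ^ 1) = 0 := by linarith
      rcases mul_eq_zero.1 h2 with h3 | h3
      · nlinarith
      · exact h3
    | m + 2, ih, hm, h =>
      have e : L * derivative ((1 - X ^ 2) * derivative (X ^ (m + 2)))
          = C (((m : ℝ) + 2) * (m + 1)) * (L * X ^ m)
            - C (((m : ℝ) + 2) * (m + 3)) * (L * X ^ (m + 2)) := by
        simp [map_ofNat]; ring
      rw [e, map_sub, intI_C_mul, intI_C_mul, ih m (by omega) (by omega)] at h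
      push_cast at hm
      have h2 : ((N : ℝ) * (N + 1) - ((m : ℝ) + 2) * (m + 3)) * intI (L * X ^ (m + 2)) = 0 := by
        linarith
      rcases mul_eq_zero.1 h2 with h3 | h3
      · have : (0 : ℝ) ≤ m := by positivity
        nlinarith
      · exact h3

lemma abs_orth (hode : derivative ((1 - X ^ 2) * derivative L) = - C ((N : ℝ) * (N + 1)) * L)
    (p : ℝ[X]) (hp : p.degree < N) : intI (L * p) = 0 := by
  by_cases h0 : p = 0
  · simp [h0]
  have hp' : p.natDegree < N := (natDegree_lt_iff_degree_lt h0).2 hp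
  rw [p.as_sum_range' N hp', Finset.mul_sum, map_sum]
  refine Finset.sum_eq_zero fun i hi => ?_
  rw [← C_mul_X_pow_eq_monomial, mul_left_comm, intI_C_mul,
    abs_orth_pow hode i (Finset.mem_range.1 hi), mul_zero]

/-- the remainder after removing the top coefficient has degree `< N` -/
lemma abs_deg_sub (hL : L.natDegree ≤ N) (hc : L.coeff N ≠ 0)
    (p : ℝ[X]) (hp : p.natDegree ≤ N) :
    (p - C (p.coeff N / L.coeff N) * L).degree < N := by
  rw [degree_lt_iff_coeff_zero]
  intro m hm
  rcases hm.eq_or_lt with rfl | hm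
  · simp; field_simp; simp
  · simp [coeff_eq_zero_of_natDegree_lt (hp.trans_lt hm),
      coeff_eq_zero_of_natDegree_lt (hL.trans_lt hm)]

lemma abs_orth_top
    (hode : derivative ((1 - X ^ 2) * derivative L) = - C ((N : ℝ) * (N + 1)) * L)
    (hL : L.natDegree ≤ N) (hc : L.coeff N ≠ 0)
    (p : ℝ[X]) (hp : p.natDegree ≤ N) :
    intI (L * p) = p.coeff N / L.coeff N * intI (L * L) := by
  have h := abs_orth hode _ (abs_deg_sub hL hc p hp)
  rw [mul_sub, map_sub, mul_left_comm, intI_C_mul] at h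
  linarith

lemma abs_normsq
    (hode : derivative ((1 - X ^ 2) * derivative L) = - C ((N : ℝ) * (N + 1)) * L)
    (hL : L.natDegree ≤ N) (hc : L.coeff N ≠ 0) (hN : 1 ≤ N)
    (h1 : L.eval 1 ^ 2 = 1) (h2 : L.eval (-1) ^ 2 = 1) :
    intI (L * L) = 2 / (2 * N + 1) := by
  obtain ⟨n, rfl⟩ : ∃ n, N = n + 1 := ⟨N - 1, by omega⟩
  have h := intI_derivative (X * (L * L))
  have e : derivative (X * (L * L)) = L * L + C 2 * (L * (X * derivative L)) := by
    simp [derivative_mul, map_ofNat]; ring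
  have hd : (X * derivative L).natDegree ≤ n + 1 := by
    refine natDegree_mul_le.trans ?_
    have := natDegree_derivative_le L
    rw [natDegree_X]; omega
  rw [e, map_add, intI_C_mul, abs_orth_top hode hL hc _ hd, coeff_X_mul, coeff_derivative] at h
  simp only [eval_mul, eval_X] at h
  have e2 : L.coeff (n + 1) * ((n : ℝ) + 1) / L.coeff (n + 1) = n + 1 := by field_simp
  rw [e2] at h
  push_cast
  rw [eq_div_iff (by positivity)]
  nlinarith

lemma exists_antideriv (n : ℕ) (q : ℝ[X]) (hq : q.natDegree ≤ n) :
    ∃ Q : ℝ[X], derivative Q = q ∧ Q.natDegree ≤ n + 1 ∧ Q.coeff (n + 1) = q.coeff n / (n + 1) := by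
  refine ⟨∑ i ∈ Finset.range (n + 1), monomial (i + 1) (q.coeff i / (i + 1)), ?_, ?_, ?_⟩
  · rw [derivative_sum]
    conv_rhs => rw [q.as_sum_range' (n + 1) (by omega)]
    refine Finset.sum_congr rfl fun i _ => ?_
    rw [derivative_monomial]
    have : (i : ℝ) + 1 ≠ 0 := by positivity
    push_cast
    rw [div_mul_cancel₀ _ this]
  · refine natDegree_sum_le_of_forall_le _ _ fun i hi => (natDegree_monomial_le _).trans ?_
    have := Finset.mem_range.1 hi
    omega
  · rw [finsetSum_coeff, Finset.sum_eq_single n]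
    · simp
    · intro b _ hb
      rw [coeff_monomial, if_neg (by omega)]
    · simp

lemma abs_omega_int
    (hode : derivative ((1 - X ^ 2) * derivative L) = - C ((N : ℝ) * (N + 1)) * L)
    (hL : L.natDegree ≤ N) (hc : L.coeff N ≠ 0) (n : ℕ) (hN : N = n + 1)
    (h1 : L.eval 1 ^ 2 = 1) (h2 : L.eval (-1) ^ 2 = 1) (q : ℝ[X]) (hq : q.natDegree ≤ n) :
    intI ((1 - X ^ 2) * derivative L * q) =
      (N + 1) * (q.coeff n / L.coeff N) * (2 / (2 * N + 1)) := by
  obtain ⟨Q, rfl, hQ, hQc⟩ := exists_antideriv n q hq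
  rw [abs_parts hode, abs_orth_top hode hL hc Q (by omega),
    abs_normsq hode hL hc (by omega) h1 h2]
  subst hN
  rw [hQc]
  push_cast
  have : (n : ℝ) + 1 ≠ 0 := by positivity
  field_simp

lemma abs_omega_deg (hL : L.natDegree ≤ N) (n : ℕ) (hN : N = n + 1) :
    ((1 - X ^ 2) * derivative L).natDegree ≤ n + 2 := by
  refine natDegree_mul_le.trans ?_
  have h1 := natDegree_derivative_le L
  have h2 : ((1 : ℝ[X]) - X ^ 2).natDegree ≤ 2 := by
    refine (natDegree_sub_le _ _).trans ?_
    simp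
  omega

lemma abs_omega_coeff (hL : L.natDegree ≤ N) (n : ℕ) (hN : N = n + 1) :
    ((1 - X ^ 2) * derivative L).coeff (n + 2) = - (N * L.coeff N) := by
  rw [sub_mul, one_mul, coeff_sub, coeff_X_pow_mul, coeff_derivative, coeff_derivative,
    coeff_eq_zero_of_natDegree_lt (by omega : L.natDegree < n + 2 + 1)]
  subst hN
  push_cast
  ring

lemma exists_div_linear (m : ℕ) (p : ℝ[X]) (hp : p.natDegree ≤ m + 1) (a : ℝ)
    (ha : p.eval a = 0) :
    ∃ q : ℝ[X], (X - C a) * q = p ∧ q.natDegree ≤ m ∧ q.coeff m = p.coeff (m + 1) := by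
  have h1 := mul_divByMonic_eq_iff_isRoot.2 (show IsRoot p a from ha)
  have h2 : (p /ₘ (X - C a)).natDegree ≤ m := by
    rw [natDegree_divByMonic _ (monic_X_sub_C a), natDegree_X_sub_C]; omega
  refine ⟨_, h1, h2, ?_⟩
  conv_rhs => rw [← h1]
  rw [sub_mul, coeff_sub, coeff_X_mul, coeff_C_mul,
    coeff_eq_zero_of_natDegree_lt (by omega : (p /ₘ (X - C a)).natDegree < m + 1)]
  ring

lemma abs_psi
    (hode : derivative ((1 - X ^ 2) * derivative L) = - C ((N : ℝ) * (N + 1)) * L)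
    (hL : L.natDegree ≤ N) (hc : L.coeff N ≠ 0) (n : ℕ) (hN : N = n + 1)
    (h1 : L.eval 1 ^ 2 = 1) (h2 : L.eval (-1) ^ 2 = 1) (a : ℝ)
    (ha : ((1 - X ^ 2) * derivative L).eval a = 0) :
    ∃ ψ : ℝ[X], (X - C a) * ψ = (1 - X ^ 2) * derivative L ∧ ψ.natDegree ≤ N ∧
      L.eval a * intI ψ = -2 ∧ ψ.eval a = - (N * (N + 1) * L.eval a) := by
  obtain ⟨ψ, hψ, hd, hco⟩ := exists_div_linear (n + 1) _ (abs_omega_deg hL n hN) a ha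
  obtain ⟨r, hr, hrd, hrc⟩ := exists_div_linear n (L - C (L.eval a))
    ((natDegree_sub_C).trans_le (by omega)) a (by simp)
  rw [abs_omega_coeff hL n hN] at hco
  refine ⟨ψ, hψ, by omega, ?_, ?_⟩
  · have e : L * ψ = C (L.eval a) * ψ + (1 - X ^ 2) * derivative L * r := by
      rw [← hψ]
      linear_combination (-ψ) * hr
    have h := congrArg intI e
    rw [map_add, intI_C_mul, abs_omega_int hode hL hc n hN h1 h2 r hrd,
      abs_orth_top hode hL hc ψ (by omega), abs_normsq hode hL hc (by omega) h1 h2, hrc] at h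
    subst hN
    rw [hco] at h
    simp only [coeff_sub, coeff_C_succ, sub_zero] at h
    rw [div_self hc] at h
    have e3 : -(((n + 1 : ℕ) : ℝ) * L.coeff (n + 1)) / L.coeff (n + 1) = - ((n + 1 : ℕ) : ℝ) := by
      field_simp
    rw [e3] at h
    have e4 : (2 / (2 * ((n + 1 : ℕ) : ℝ) + 1)) * (2 * ((n + 1 : ℕ) : ℝ) + 1) = 2 :=
      div_mul_cancel₀ _ (by positivity)
    linear_combination (-1) * h - e4
  · have h := congrArg (eval a) hode
    rw [← hψ] at h
    simpa [derivative_mul] using h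

variable {x w : Fin (N + 1) → ℝ}

lemma abs_L_ne
    (hode : derivative ((1 - X ^ 2) * derivative L) = - C ((N : ℝ) * (N + 1)) * L)
    (hL : L.natDegree ≤ N) (hc : L.coeff N ≠ 0) (hN : 1 ≤ N)
    (h1 : L.eval 1 ^ 2 = 1) (h2 : L.eval (-1) ^ 2 = 1) (a : ℝ)
    (ha : ((1 - X ^ 2) * derivative L).eval a = 0) : L.eval a ≠ 0 := by
  obtain ⟨ψ, -, -, h, -⟩ := abs_psi hode hL hc (N - 1) (by omega) h1 h2 a ha
  intro h0
  rw [h0] at h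
  norm_num at h

lemma abs_quad_low
    (hode : derivative ((1 - X ^ 2) * derivative L) = - C ((N : ℝ) * (N + 1)) * L)
    (hL : L.natDegree ≤ N) (hc : L.coeff N ≠ 0) (hN : 1 ≤ N)
    (h1 : L.eval 1 ^ 2 = 1) (h2 : L.eval (-1) ^ 2 = 1)
    (hinj : Function.Injective x)
    (hnodes : ∀ j, ((1 - X ^ 2) * derivative L).eval (x j) = 0)
    (hw : ∀ j, w j = 2 / ((N : ℝ) * (N + 1) * (L.eval (x j)) ^ 2))
    (p : ℝ[X]) (hp : p.natDegree ≤ N) : ∑ j, p.eval (x j) * w j = intI p := by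
  have hne := fun j => abs_L_ne hode hL hc hN h1 h2 (x j) (hnodes j)
  choose ψ hψ hd hi he using
    fun j => abs_psi hode hL hc (N - 1) (by omega) h1 h2 (x j) (hnodes j)
  have hNR : (0 : ℝ) < N := by exact_mod_cast hN
  have hψ0 : ∀ j, (ψ j).eval (x j) ≠ 0 := by
    intro j
    rw [he]
    have := hne j
    have : (N : ℝ) * (N + 1) * L.eval (x j) ≠ 0 := by positivity
    exact neg_ne_zero.2 this
  have key : p - ∑ j, C (p.eval (x j) / (ψ j).eval (x j)) * ψ j = 0 := by
    refine eq_zero_of_natDegree_lt_card_of_eval_eq_zero _ hinj ?_ ?_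
    · intro i
      rw [eval_sub, eval_finsetSum, Finset.sum_eq_single i]
      · rw [eval_C_mul, div_mul_cancel₀ _ (hψ0 i), sub_self]
      · intro j _ hj
        have h := congrArg (eval (x i)) (hψ j)
        rw [hnodes i, eval_mul] at h
        rcases mul_eq_zero.1 h with h | h
        · simp only [eval_sub, eval_X, eval_C, sub_eq_zero] at h
          exact absurd (hinj h).symm hj
        · rw [eval_C_mul, h, mul_zero]
      · simp
    · rw [Fintype.card_fin]
      refine Nat.lt_succ_of_le ((natDegree_sub_le _ _).trans (max_le hp ?_))
      exact natDegree_sum_le_of_forall_le _ _ fun j _ => (natDegree_C_mul_le _ _).trans (hd j)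
  conv_rhs => rw [sub_eq_zero.1 key]
  rw [map_sum]
  refine Finset.sum_congr rfl fun j _ => ?_
  rw [intI_C_mul, hw, he]
  have h3 := hne j
  have h4 : intI (ψ j) = -2 / L.eval (x j) := by
    rw [eq_div_iff h3, mul_comm]; exact hi j
  rw [h4]
  field_simp

lemma abs_quad
    (hode : derivative ((1 - X ^ 2) * derivative L) = - C ((N : ℝ) * (N + 1)) * L)
    (hL : L.natDegree ≤ N) (hc : L.coeff N ≠ 0) (hN : 1 ≤ N)
    (h1 : L.eval 1 ^ 2 = 1) (h2 : L.eval (-1) ^ 2 = 1)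
    (hinj : Function.Injective x)
    (hnodes : ∀ j, ((1 - X ^ 2) * derivative L).eval (x j) = 0)
    (hw : ∀ j, w j = 2 / ((N : ℝ) * (N + 1) * (L.eval (x j)) ^ 2))
    (p : ℝ[X]) (hp : p.natDegree < 2 * N) : ∑ j, p.eval (x j) * w j = intI p := by
  have hlow := abs_quad_low hode hL hc hN h1 h2 hinj hnodes hw
  obtain ⟨n, hn⟩ : ∃ n, N = n + 1 := ⟨N - 1, by omega⟩
  have hint := abs_omega_int hode hL hc n hn h1 h2
  have hdeg := abs_omega_deg hL n hn
  have hco := abs_omega_coeff hL n hn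
  generalize (1 - X ^ 2) * derivative L = ω at *
  have hNR : (0 : ℝ) < N := by exact_mod_cast hN
  have hco' : ω.coeff (n + 2) ≠ 0 := by
    rw [hco]; exact neg_ne_zero.2 (mul_ne_zero hNR.ne' hc)
  have hω0 : ω ≠ 0 := by rintro rfl; simp at hco'
  have hωd : ω.natDegree = n + 2 := le_antisymm hdeg (le_natDegree_of_ne_zero hco')
  have hdiv := EuclideanDomain.div_add_mod p ω
  have hq : (p / ω).degree < n := by
    by_cases hlt : p.degree < ω.degree
    · rw [(Polynomial.div_eq_zero_iff hω0).2 hlt, degree_zero]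
      exact WithBot.bot_lt_coe _
    · have h := degree_add_div hω0 (not_lt.1 hlt)
      have hq0 : p / ω ≠ 0 := fun h => hlt ((Polynomial.div_eq_zero_iff hω0).1 h)
      have hp0 : p ≠ 0 := by rintro rfl; simp at hq0
      rw [degree_eq_natDegree hω0, degree_eq_natDegree hq0, degree_eq_natDegree hp0] at h
      rw [← natDegree_lt_iff_degree_lt hq0]
      norm_cast at h
      omega
  have hm : (p % ω).natDegree ≤ N := by
    have := natDegree_mod_lt p (q := ω) (by omega)
    omega
  have hI : intI p = intI (p % ω) := by
    conv_lhs => rw [← hdiv]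
    rw [map_add, hint _ (natDegree_le_iff_degree_le.2 hq.le), coeff_eq_zero_of_degree_lt hq]
    simp
  rw [hI, ← hlow _ hm]
  refine Finset.sum_congr rfl fun j _ => ?_
  conv_lhs => rw [← hdiv]
  rw [eval_add, eval_mul, hnodes j]
  simp

lemma abs_main
    (hode : derivative ((1 - X ^ 2) * derivative L) = - C ((N : ℝ) * (N + 1)) * L)
    (hL : L.natDegree ≤ N) (hc : L.coeff N ≠ 0) (hN : 1 ≤ N)
    (h1 : L.eval 1 ^ 2 = 1) (h2 : L.eval (-1) ^ 2 = 1)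
    (hinj : Function.Injective x)
    (hnodes : ∀ j, ((1 - X ^ 2) * derivative L).eval (x j) = 0)
    (hw : ∀ j, w j = 2 / ((N : ℝ) * (N + 1) * (L.eval (x j)) ^ 2))
    (U : ℝ[X]) (hU : U.natDegree ≤ N) :
    intI (U ^ 2) ≤ ∑ j, U.eval (x j) ^ 2 * w j ∧
      ∑ j, U.eval (x j) ^ 2 * w j ≤ 3 * intI (U ^ 2) := by
  have hquad := abs_quad hode hL hc hN h1 h2 hinj hnodes hw
  have hne := fun j => abs_L_ne hode hL hc hN h1 h2 (x j) (hnodes j)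
  have hNR : (1 : ℝ) ≤ N := by exact_mod_cast hN
  have hV := abs_deg_sub hL hc U hU
  set a := U.coeff N / L.coeff N
  set V := U - C a * L with hVdef
  have hUV : U = C a * L + V := by rw [hVdef]; ring
  have hVn : V.natDegree < N := by
    by_cases h0 : V = 0
    · rw [h0, natDegree_zero]; omega
    · exact (natDegree_lt_iff_degree_lt h0).2 hV
  have hLV : intI (L * V) = 0 := abs_orth hode V hV
  have hLL := abs_normsq hode hL hc hN h1 h2
  have hVpos : 0 ≤ intI (V * V) := by
    rw [intI_apply]
    refine intervalIntegral.integral_nonneg (by norm_num) fun t _ => ?_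
    rw [eval_mul]; exact mul_self_nonneg _
  have hQLV := hquad (L * V) (natDegree_mul_le.trans_lt (by omega))
  have hQVV := hquad (V * V) (natDegree_mul_le.trans_lt (by omega))
  have hQLL : ∑ j, L.eval (x j) ^ 2 * w j = 2 / N := by
    have : ∀ j, L.eval (x j) ^ 2 * w j = 2 / (N * (N + 1)) := by
      intro j
      rw [hw]
      have := hne j
      field_simp
    simp only [this, Finset.sum_const, Finset.card_univ, Fintype.card_fin, nsmul_eq_mul]
    push_cast
    field_simp
  have hIU : intI (U ^ 2) = a ^ 2 * (2 / (2 * N + 1)) + intI (V * V) := by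
    have e : U ^ 2 = C (a ^ 2) * (L * L) + C (2 * a) * (L * V) + V * V := by
      rw [hUV]; simp only [map_pow, map_mul, map_ofNat]; ring
    rw [e, map_add, map_add, intI_C_mul, intI_C_mul, hLL, hLV]
    ring
  have hQU : ∑ j, U.eval (x j) ^ 2 * w j = a ^ 2 * (2 / N) + intI (V * V) := by
    have e : ∀ j, U.eval (x j) ^ 2 * w j = a ^ 2 * (L.eval (x j) ^ 2 * w j)
        + 2 * a * ((L * V).eval (x j) * w j) + (V * V).eval (x j) * w j := by
      intro j
      rw [hUV]; simp only [eval_add, eval_mul, eval_C]; ring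
    simp only [e, Finset.sum_add_distrib, ← Finset.mul_sum]
    rw [hQLL, hQLV, hQVV, hLV]
    ring
  rw [hIU, hQU]
  have hA : (2 : ℝ) / (2 * N + 1) ≤ 2 / N := by gcongr; linarith
  have hB : (2 : ℝ) / N ≤ 3 * (2 / (2 * N + 1)) := by
    rw [← mul_div_assoc, div_le_div_iff₀ (by positivity) (by positivity)]
    linarith
  constructor
  · nlinarith [mul_le_mul_of_nonneg_left hA (sq_nonneg a)]
  · nlinarith [mul_le_mul_of_nonneg_left hB (sq_nonneg a)]

end abs

/-- Equivalence of the continuous `L²(-1,1)` norm and the discrete norm induced by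
Legendre–Gauss–Lobatto quadrature with `N+1` nodes, for polynomials of degree ≤ N:
`‖U‖_{L²} ≤ ‖U‖_N ≤ √3 ‖U‖_{L²}`.  The LGL nodes are the `N+1` distinct roots of
`(1-x²)L_N'(x)` and the weights are `w_j = 2/(N(N+1)L_N(x_j)²)`. -/
theorem lgl_norm_equivalence (N : ℕ) (hN : 1 ≤ N)
    (x w : Fin (N + 1) → ℝ) (hinj : Function.Injective x)
    (hnodes : ∀ j, ((1 - X ^ 2) * derivative (legendreR N)).eval (x j) = 0)
    (hw : ∀ j, w j = 2 / ((N : ℝ) * (N + 1) * ((legendreR N).eval (x j)) ^ 2))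
    (U : Polynomial ℝ) (hU : U.degree ≤ (N : ℕ)) :
    Real.sqrt (∫ t in (-1 : ℝ)..1, (U.eval t) ^ 2)
        ≤ Real.sqrt (∑ j, (U.eval (x j)) ^ 2 * w j) ∧
    Real.sqrt (∑ j, (U.eval (x j)) ^ 2 * w j)
        ≤ Real.sqrt 3 * Real.sqrt (∫ t in (-1 : ℝ)..1, (U.eval t) ^ 2) := by
  have h := abs_main (leg_ode N) (leg_natDegree N) (leg_coeff N) hN (leg_one N) (leg_neg_one N)
    hinj hnodes hw U (natDegree_le_iff_degree_le.2 hU)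
  rw [intI_apply] at h
  simp only [eval_pow] at h
  refine ⟨Real.sqrt_le_sqrt h.1, ?_⟩
  rw [← Real.sqrt_mul (by norm_num)]
  exact Real.sqrt_le_sqrt h.2
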